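/- arXiv:1110.2404 — 5 statements merged into one kernel-verified Lean document; each statement's English description precedes it below -/
import Mathlib

section
/- Let r, s be nonnegative integers and λ, a₁, a₂ ∈ ℂ. Then λ^{s·(C(r+s,2)−C(r,2))} · Π_{1≤i,j≤s}(λ^{j+s−1}−λ^{i−1}) · det 𝒢^{(0,r,s)}(λ,a₁,a₂) = (−1)^{s(r+s)} · (a₁a₂)^{C(r+s,2)} · Π_{1≤i,j≤s}(λ^{j−1}a₁ − λ^{i−1}a₂) · Π_{1≤i<j≤r}(λ^{j−1}−λ^{i−1}) · Π_{1≤i<j≤r+2s}(λ^{j−1}−λ^{i−1}), where C(m,2) = m(m−1)/2 denotes the binomial coefficient. -/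
noncomputable section

/-- The block matrix `𝒢^{(ℓ,r,s)}(v;λ,a₁,a₂)` of size `2(ℓ+r+s)`. -/
def Gmat {K : Type*} [CommRing K] (l r s : ℕ) (v : Fin l → K) (lam a1 a2 : K) :
    Matrix (Fin (2*(l+r+s))) (Fin (2*(l+r+s))) K :=
  Matrix.of fun i j =>
    if (i.val < l + r ∧ l + (r+s) ≤ j.val) ∨
        (l + r ≤ i.val ∧ i.val < 2*(l+r) ∧ j.val < l + (r+s)) then 0
    else
      (if h1 : j.val < l then v ⟨j.val, h1⟩
        else if h2 : j.val < l + (r+s) then a1 * lam ^ (j.val - l)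
        else if h3 : j.val < l + (r+s) + l then v ⟨j.val - (l + (r+s)), by omega⟩
        else a2 * lam ^ (j.val - (l + (r+s) + l)))
      ^ (if i.val < l + r then i.val else i.val - (l + r))

/-- The Vandermonde product of the first `m` terms of the sequence `x`. -/
def vandermondeProd {K : Type*} [CommRing K] (x : ℕ → K) (m : ℕ) : K :=
  ∏ j ∈ Finset.range m, ∏ i ∈ Finset.range j, (x j - x i)

section

variable {K : Type*} [CommRing K]

open Finset

theorem vandermondeProd_succ (x : ℕ → K) (m : ℕ) :
    vandermondeProd x (m + 1) = vandermondeProd x m * ∏ i ∈ range m, (x m - x i) :=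
  prod_range_succ _ _

theorem prod_prod_ite_lt_eq_vandermondeProd (x : ℕ → K) (m : ℕ) :
    (∏ i : Fin m, ∏ j : Fin m, if (i : ℕ) < (j : ℕ) then x j - x i else 1) =
      vandermondeProd x m := by
  have h (i : Fin m) : (∏ j : Fin m, if (i : ℕ) < (j : ℕ) then x j - x i else 1) =
      ∏ j ∈ range m, if (i : ℕ) < j then x j - x i else 1 :=
    Fin.prod_univ_eq_prod_range (fun j => if (i : ℕ) < j then x j - x i else 1) m
  simp_rw [h]
  rw [Fin.prod_univ_eq_prod_range
    (fun i => ∏ j ∈ range m, if i < j then x j - x i else 1) m, prod_comm]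
  refine prod_congr rfl fun j hj => ?_
  rw [← prod_filter]
  refine prod_congr ?_ fun _ _ => rfl
  ext i
  simp only [mem_filter, mem_range] at hj ⊢
  omega

theorem vandermondeProd_add (x : ℕ → K) (m n : ℕ) :
    vandermondeProd x (m + n) = vandermondeProd x m * vandermondeProd (fun j => x (m + j)) n *
      ∏ i ∈ range m, ∏ j ∈ range n, (x (m + j) - x i) := by
  rw [prod_comm]
  simp only [vandermondeProd, prod_range_add, prod_mul_distrib]
  ring

theorem vandermondeProd_const_mul (c : K) (x : ℕ → K) (m : ℕ) :
    vandermondeProd (fun j => c * x j) m = c ^ m.choose 2 * vandermondeProd x m := by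
  induction m with
  | zero => simp [vandermondeProd]
  | succ m ih =>
    rw [vandermondeProd_succ, vandermondeProd_succ, ih, Nat.choose_succ_succ' m 1,
      Nat.choose_one_right]
    simp_rw [← mul_sub, prod_mul_distrib, prod_const, card_range]
    ring

theorem det_vandermonde_eq_vandermondeProd (x : ℕ → K) (m : ℕ) :
    (Matrix.vandermonde fun i : Fin m => x i).det = vandermondeProd x m := by
  rw [Matrix.det_vandermonde, ← prod_prod_ite_lt_eq_vandermondeProd]
  refine prod_congr rfl fun i _ => ?_
  rw [← prod_filter]
  refine prod_congr ?_ fun _ _ => rfl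
  ext j
  simp

theorem prod_pow_sub_pow (q : K) (m : ℕ) :
    ∏ i ∈ range m, (q ^ m - q ^ i) = q ^ m.choose 2 * ∏ k ∈ range m, (q ^ (k + 1) - 1) := by
  rw [Nat.choose_two_right, ← sum_range_id, ← prod_pow_eq_pow_sum]
  rw [← prod_range_reflect (fun k => q ^ (k + 1) - 1), ← prod_mul_distrib]
  refine prod_congr rfl fun i hi => ?_
  have := mem_range.mp hi
  rw [mul_sub, ← pow_add, mul_one]
  congr 2
  omega

/-- The nodes of two geometric progressions, the first one having length `n`. -/
def geomNode (n : ℕ) (q a b : K) (j : ℕ) : K :=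
  if j < n then a * q ^ j else b * q ^ (j - n)

/-- The matrix of monomials at the nodes of two geometric progressions, in which the monomials
of degree less than `r` occur separately for the two progressions and the others are shared. -/
def geomGlueMatrix (m r n : ℕ) (q a b : K) : Matrix (Fin m) (Fin m) K :=
  Matrix.of fun i j =>
    if (i.val < r ∧ n ≤ j.val) ∨ (r ≤ i.val ∧ i.val < 2 * r ∧ j.val < n) then 0
    else geomNode n q a b j ^ (if i.val < r then i.val else i.val - r)

/-- The result of subtracting from each column of `geomGlueMatrix` its predecessor within
the same progression. -/
def geomGlueDiff (m r n : ℕ) (q a b : K) : Matrix (Fin (m + 1)) (Fin (m + 1)) K :=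
  Matrix.of fun i j =>
    if (i.val < r ∧ n ≤ j.val) ∨ (r ≤ i.val ∧ i.val < 2 * r ∧ j.val < n) then 0
    else if j.val = 0 ∨ j.val = n then
      geomNode n q a b j ^ (if i.val < r then i.val else i.val - r)
    else geomNode n q a b j ^ (if i.val < r then i.val else i.val - r) -
      geomNode n q a b (j - 1) ^ (if i.val < r then i.val else i.val - r)

theorem det_geomGlueMatrix_eq_det_geomGlueDiff (m r n : ℕ) (q a b : K) :
    (geomGlueMatrix (m + 1) r n q a b).det = (geomGlueDiff m r n q a b).det := by
  refine Matrix.det_eq_of_forall_col_eq_smul_add_pred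
    (fun j => if j.val + 1 = n then 0 else 1) (fun i => ?_) (fun i j => ?_)
  · simp [geomGlueMatrix, geomGlueDiff]
  · simp only [geomGlueMatrix, geomGlueDiff, Matrix.of_apply, Fin.val_succ, Fin.val_castSucc,
      Nat.add_sub_cancel, Nat.add_eq_zero_iff, one_ne_zero, and_false, false_or]
    by_cases hn : j.val + 1 = n
    · simp [hn]
    · have h : n ≤ j.val + 1 ↔ n ≤ j.val := by omega
      have h' : j.val + 1 < n ↔ j.val < n := by omega
      simp only [h, h', hn, if_false]
      split_ifs <;> ring

theorem geomNode_succ_pow_sub {n l : ℕ} (hl : l + 1 ≠ n) (q a b : K) (e : ℕ) :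
    geomNode n q a b (l + 1) ^ e - geomNode n q a b l ^ e =
      (q ^ e - 1) * geomNode n q a b l ^ e := by
  have : geomNode n q a b (l + 1) = q * geomNode n q a b l := by
    unfold geomNode
    by_cases h : l < n
    · rw [if_pos (by omega), if_pos h]; ring
    · rw [if_neg (by omega), if_neg h, Nat.sub_add_comm (by omega)]; ring
  rw [this]
  ring

theorem Fin.val_succ_succAbove {m : ℕ} (p : Fin (m + 1)) (k : Fin m) :
    ((p.succAbove k).succ : ℕ) = if k.val < p.val then k.val + 1 else k.val + 2 := by
  rw [Fin.val_succ]
  split_ifs with h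
  · rw [Fin.succAbove_of_castSucc_lt _ _ (by simpa [Fin.lt_def] using h), Fin.val_castSucc]
  · rw [Fin.succAbove_of_le_castSucc _ _ (by simpa [Fin.le_def] using h), Fin.val_succ]

theorem geomGlueDiff_submatrix {m r n : ℕ} (q a b : K) (p c : Fin (m + 1)) (hp : p.val = r)
    (hc : c.val = n) :
    ((geomGlueDiff (m + 1) (r + 1) (n + 1) q a b).submatrix Fin.succ Fin.succ).submatrix
      p.succAbove c.succAbove =
    Matrix.of fun i j : Fin m => (q ^ ((if i.val < r then i.val else i.val - r) + 1) - 1) *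
      Matrix.of (fun i j : Fin m => geomNode n q a b j * geomGlueMatrix m r n q a b i j) i j := by
  ext i j
  simp only [geomGlueDiff, geomGlueMatrix, Matrix.submatrix_apply, Matrix.of_apply,
    Fin.val_succ_succAbove, hp, hc]
  have hexp : (if (if i.val < r then i.val + 1 else i.val + 2) < r + 1 then
      (if i.val < r then i.val + 1 else i.val + 2)
      else (if i.val < r then i.val + 1 else i.val + 2) - (r + 1)) =
      (if i.val < r then i.val else i.val - r) + 1 := by
    split_ifs <;> omega
  rw [hexp]
  generalize (if i.val < r then i.val else i.val - r) = e
  have hzero : (((if i.val < r then i.val + 1 else i.val + 2) < r + 1 ∧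
        n + 1 ≤ (if j.val < n then j.val + 1 else j.val + 2)) ∨
      (r + 1 ≤ (if i.val < r then i.val + 1 else i.val + 2) ∧
        (if i.val < r then i.val + 1 else i.val + 2) < 2 * (r + 1) ∧
        (if j.val < n then j.val + 1 else j.val + 2) < n + 1)) ↔
      ((i.val < r ∧ n ≤ j.val) ∨ (r ≤ i.val ∧ i.val < 2 * r ∧ j.val < n)) := by
    grind
  have hbd : ¬ ((if j.val < n then j.val + 1 else j.val + 2) = 0 ∨
      (if j.val < n then j.val + 1 else j.val + 2) = n + 1) := by
    grind
  simp only [hzero, if_neg hbd]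
  split_ifs with h h'
  · simp
  · rw [Nat.add_sub_cancel, geomNode_succ_pow_sub (by omega)]
    simp only [geomNode, h', if_true, show j.val < n + 1 by omega]
    ring
  · rw [show j.val + 2 - 1 = j.val + 1 by omega, show j.val + 2 = j.val + 1 + 1 by omega,
      geomNode_succ_pow_sub (by omega)]
    simp only [geomNode, h', if_false, show ¬ j.val + 1 < n + 1 by omega, Nat.add_sub_add_right]
    ring

theorem det_geomGlueDiff {m r n : ℕ} (hr : r ≤ m) (hn : n ≤ m) (q a b : K) :
    (geomGlueDiff (m + 1) (r + 1) (n + 1) q a b).det = (-1) ^ (r + n) *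
      (((geomGlueDiff (m + 1) (r + 1) (n + 1) q a b).submatrix Fin.succ Fin.succ).submatrix
        (Fin.succAbove ⟨r, Nat.lt_succ_of_le hr⟩)
        (Fin.succAbove ⟨n, Nat.lt_succ_of_le hn⟩)).det := by
  rw [Matrix.det_succ_row_zero, sum_eq_single 0]
  · have h1 : geomGlueDiff (m + 1) (r + 1) (n + 1) q a b 0 0 = 1 := by simp [geomGlueDiff]
    rw [h1, Fin.succAbove_zero, Fin.val_zero, pow_zero, one_mul, one_mul,
      Matrix.det_succ_row _ ⟨r, Nat.lt_succ_of_le hr⟩,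
      sum_eq_single ⟨n, Nat.lt_succ_of_le hn⟩]
    · have h2 : (geomGlueDiff (m + 1) (r + 1) (n + 1) q a b).submatrix Fin.succ Fin.succ
          ⟨r, Nat.lt_succ_of_le hr⟩ ⟨n, Nat.lt_succ_of_le hn⟩ = 1 := by
        simp [geomGlueDiff]
      rw [h2, mul_one]
    · intro j _ hj
      have hj' : j.val ≠ n := fun h => hj (Fin.ext h)
      have h2 : (geomGlueDiff (m + 1) (r + 1) (n + 1) q a b).submatrix Fin.succ Fin.succ
          ⟨r, Nat.lt_succ_of_le hr⟩ j = 0 := by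
        simp [geomGlueDiff, hj']
      rw [h2, mul_zero, zero_mul]
    · simp
  · intro j _ hj
    have hj' : j.val ≠ 0 := fun h => hj (Fin.ext h)
    have h1 : geomGlueDiff (m + 1) (r + 1) (n + 1) q a b 0 j = 0 := by
      simp [geomGlueDiff, hj]
      omega
    rw [h1, mul_zero, zero_mul]
  · simp

theorem prod_geomNode (n : ℕ) (q a b : K) :
    ∏ j ∈ range (n + n), geomNode n q a b j = (a * b) ^ n * q ^ (2 * n.choose 2) := by
  have h1 : ∏ j ∈ range n, geomNode n q a b j = a ^ n * q ^ n.choose 2 := by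
    rw [prod_congr rfl fun j hj => show geomNode n q a b j = a * q ^ j from
      if_pos (mem_range.mp hj), prod_mul_distrib, prod_const, card_range, prod_pow_eq_pow_sum,
      sum_range_id, ← Nat.choose_two_right]
  have h2 : ∏ j ∈ range n, geomNode n q a b (n + j) = b ^ n * q ^ n.choose 2 := by
    rw [prod_congr rfl fun j _ => show geomNode n q a b (n + j) = b * q ^ j by
      simp [geomNode], prod_mul_distrib, prod_const, card_range, prod_pow_eq_pow_sum,
      sum_range_id, ← Nat.choose_two_right]
  rw [prod_range_add, h1, h2]
  ring

theorem det_geomGlueMatrix_succ (r s : ℕ) (q a b : K) :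
    (geomGlueMatrix (2 * (r + 1 + s)) (r + 1) (r + 1 + s) q a b).det =
      (-1) ^ s * ((∏ k ∈ range r, (q ^ (k + 1) - 1)) *
        ∏ k ∈ range (r + 2 * s), (q ^ (k + 1) - 1)) *
      ((a * b) ^ (r + s) * q ^ (2 * (r + s).choose 2)) *
      (geomGlueMatrix (2 * (r + s)) r (r + s) q a b).det := by
  rw [show 2 * (r + 1 + s) = 2 * (r + s) + 1 + 1 by ring, show r + 1 + s = r + s + 1 by ring,
    det_geomGlueMatrix_eq_det_geomGlueDiff, det_geomGlueDiff (by omega) (by omega),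
    geomGlueDiff_submatrix (r := r) (n := r + s) q a b _ _ rfl rfl, Matrix.det_mul_column, Matrix.det_mul_row,
    Fin.prod_univ_eq_prod_range
      (fun i => q ^ ((if i < r then i else i - r) + 1) - 1) (2 * (r + s)),
    Fin.prod_univ_eq_prod_range (geomNode (r + s) q a b) (2 * (r + s)), two_mul (r + s),
    prod_geomNode, show r + s + (r + s) = r + (r + 2 * s) by ring, prod_range_add,
    prod_congr rfl fun k hk => show (q ^ ((if k < r then k else k - r) + 1) - 1) =
      q ^ (k + 1) - 1 by rw [if_pos (mem_range.mp hk)]]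
  have hsign : (-1 : K) ^ (r + (r + s)) = (-1) ^ s := by
    rw [← add_assoc, pow_add, ← two_mul, pow_mul]
    simp
  simp [hsign]
  ring

theorem det_geomGlueMatrix_zero (s : ℕ) (q a b : K) :
    (geomGlueMatrix (s + s) 0 s q a b).det = (a * b) ^ s.choose 2 *
      vandermondeProd (q ^ ·) s ^ 2 * ∏ i ∈ range s, ∏ j ∈ range s, (b * q ^ j - a * q ^ i) := by
  have h : geomGlueMatrix (s + s) 0 s q a b =
      (Matrix.vandermonde fun j : Fin (s + s) => geomNode s q a b j).transpose := by
    ext i j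
    simp [geomGlueMatrix, Matrix.vandermonde]
  have h1 : vandermondeProd (geomNode s q a b) s = vandermondeProd (fun j => a * q ^ j) s := by
    refine prod_congr rfl fun j hj => prod_congr rfl fun i hi => ?_
    rw [mem_range] at hi hj
    simp [geomNode, hj, hi.trans hj]
  have h2 : (fun j => geomNode s q a b (s + j)) = fun j => b * q ^ j := by
    ext j
    simp [geomNode]
  have h3 : ∏ i ∈ range s, ∏ j ∈ range s, (geomNode s q a b (s + j) - geomNode s q a b i) =
      ∏ i ∈ range s, ∏ j ∈ range s, (b * q ^ j - a * q ^ i) := by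
    refine prod_congr rfl fun i hi => prod_congr rfl fun j _ => ?_
    simp [geomNode, mem_range.mp hi]
  rw [h, Matrix.det_transpose, det_vandermonde_eq_vandermondeProd, vandermondeProd_add, h1, h2,
    h3, vandermondeProd_const_mul, vandermondeProd_const_mul]
  ring

theorem add_choose_two (r s : ℕ) :
    (r + s).choose 2 = r.choose 2 + s.choose 2 + r * s := by
  induction s with
  | zero => simp
  | succ s ih =>
    rw [← add_assoc, Nat.choose_succ_succ' (r + s) 1, Nat.choose_succ_succ' s 1, ih,
      Nat.choose_one_right, Nat.choose_one_right]
    ring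

theorem choose_two_sub_choose_two (r s : ℕ) :
    (r + s).choose 2 - r.choose 2 = r * s + s.choose 2 := by
  rw [add_choose_two]
  omega

theorem det_geomGlueMatrix (r s : ℕ) (q a b : K) :
    q ^ (s * (r * s + s.choose 2)) *
      (∏ i ∈ range s, ∏ j ∈ range s, (q ^ (j + s) - q ^ i)) *
      (geomGlueMatrix (2 * (r + s)) r (r + s) q a b).det =
    (-1) ^ (s * (r + s)) * (a * b) ^ (r + s).choose 2 *
      (∏ i ∈ range s, ∏ j ∈ range s, (q ^ j * a - q ^ i * b)) *
      vandermondeProd (q ^ ·) r * vandermondeProd (q ^ ·) (r + 2 * s) := by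
  induction r with
  | zero =>
    have h1 : ∏ i ∈ range s, ∏ j ∈ range s, (b * q ^ j - a * q ^ i) =
        (-1) ^ (s * s) * ∏ i ∈ range s, ∏ j ∈ range s, (q ^ j * a - q ^ i * b) := by
      rw [prod_comm, pow_mul]
      nth_rw 4 [← card_range s]
      rw [← prod_const, ← prod_mul_distrib]
      refine prod_congr rfl fun i _ => ?_
      nth_rw 2 [← card_range s]
      rw [← prod_const, ← prod_mul_distrib]
      exact prod_congr rfl fun j _ => by ring
    have h2 : vandermondeProd (fun j => q ^ (s + j)) s =
        q ^ (s * s.choose 2) * vandermondeProd (q ^ ·) s := by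
      simp_rw [pow_add, vandermondeProd_const_mul, pow_mul]
    rw [zero_add, zero_mul, zero_add, zero_add, two_mul]
    rw [det_geomGlueMatrix_zero, vandermondeProd_add _ s, h1, h2]
    simp only [vandermondeProd, range_zero, prod_empty, add_comm s]
    ring
  | succ r ih =>
    have hexp : s * s + 2 * (r + s).choose 2 = r.choose 2 + (r + 2 * s).choose 2 := by
      rw [two_mul s, add_choose_two r s, add_choose_two r, add_choose_two s]
      ring
    have hq : q ^ (s * s) * q ^ (2 * (r + s).choose 2) =
        q ^ r.choose 2 * q ^ (r + 2 * s).choose 2 := by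
      rw [← pow_add, ← pow_add, hexp]
    rw [det_geomGlueMatrix_succ, show r + 1 + 2 * s = r + 2 * s + 1 by ring,
      vandermondeProd_succ, vandermondeProd_succ, prod_pow_sub_pow, prod_pow_sub_pow,
      show r + 1 + s = r + s + 1 by ring, Nat.choose_succ_succ' (r + s) 1, Nat.choose_one_right,
      show s * ((r + 1) * s + s.choose 2) = s * (r * s + s.choose 2) + s * s by ring,
      show s * (r + s + 1) = s * (r + s) + s by ring, pow_add q, pow_add (-1 : K),
      pow_add (a * b)]
    linear_combination ((-1) ^ s * (a * b) ^ (r + s) * q ^ (s * s) *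
      q ^ (2 * (r + s).choose 2) * (∏ k ∈ range r, (q ^ (k + 1) - 1)) *
      ∏ k ∈ range (r + 2 * s), (q ^ (k + 1) - 1)) * ih +
      ((-1) ^ (s * (r + s)) * (a * b) ^ (r + s).choose 2 *
      (∏ i ∈ range s, ∏ j ∈ range s, (q ^ j * a - q ^ i * b)) *
      vandermondeProd (q ^ ·) r * vandermondeProd (q ^ ·) (r + 2 * s)) *
      ((-1) ^ s * (a * b) ^ (r + s) * (∏ k ∈ range r, (q ^ (k + 1) - 1)) *
      ∏ k ∈ range (r + 2 * s), (q ^ (k + 1) - 1)) * hq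

theorem det_Gmat_zero_eq_det_geomGlueMatrix (r s : ℕ) (v : Fin 0 → K) (q a b : K) :
    (Gmat 0 r s v q a b).det = (geomGlueMatrix (2 * (r + s)) r (r + s) q a b).det := by
  rw [show 2 * (r + s) = 2 * (0 + r + s) by ring]
  congr 1
  ext i j
  simp only [Gmat, geomGlueMatrix, geomNode, Matrix.of_apply, zero_add, add_zero, not_lt_zero,
    dite_false, Nat.sub_zero]
  by_cases h : j.val < r + s <;> simp [h]

end

theorem det_Gmat_zero_r_s (r s : ℕ) (lam a1 a2 : ℂ) :
    lam ^ (s * (Nat.choose (r+s) 2 - Nat.choose r 2)) *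
      (∏ i : Fin s, ∏ j : Fin s, (lam ^ ((j:ℕ) + s) - lam ^ (i:ℕ))) *
      (Gmat 0 r s (fun x => x.elim0) lam a1 a2).det =
    (-1 : ℂ) ^ (s * (r + s)) * (a1 * a2) ^ (Nat.choose (r+s) 2) *
      (∏ i : Fin s, ∏ j : Fin s, (lam ^ (j:ℕ) * a1 - lam ^ (i:ℕ) * a2)) *
      (∏ i : Fin r, ∏ j : Fin r,
        if (i:ℕ) < (j:ℕ) then (lam ^ (j:ℕ) - lam ^ (i:ℕ)) else 1) *
      (∏ i : Fin (r+2*s), ∏ j : Fin (r+2*s),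
        if (i:ℕ) < (j:ℕ) then (lam ^ (j:ℕ) - lam ^ (i:ℕ)) else 1) := by
  have h (f : ℕ → ℕ → ℂ) : ∏ i : Fin s, ∏ j : Fin s, f i j =
      ∏ i ∈ Finset.range s, ∏ j ∈ Finset.range s, f i j := by
    simp_rw [← Fin.prod_univ_eq_prod_range]
  rw [det_Gmat_zero_eq_det_geomGlueMatrix, choose_two_sub_choose_two,
    prod_prod_ite_lt_eq_vandermondeProd (lam ^ ·), prod_prod_ite_lt_eq_vandermondeProd (lam ^ ·),
    h fun i j => lam ^ (j + s) - lam ^ i, h fun i j => lam ^ j * a1 - lam ^ i * a2]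
  exact det_geomGlueMatrix r s lam a1 a2
end
end

section
/- Let n ≥ 0 and 0 ≤ k ≤ n be integers. For positive integers i, j define Q_{i,j} = 2·C(i+j−2, 2j−i−2) + C(i+j−2, 2j−i−1), where C(a,b) denotes the binomial coefficient with the convention C(a,b) = 0 whenever b < 0 or b > a. Then the determinant of the (n−k)×(n−k) matrix with (i,j) entry Q_{i+k,j+k} (1 ≤ i,j ≤ n−k), computed over ℚ, equals Π_{j=1}^{n−k} [(j−1)! · (j+2k−1)! · ((3j+3k−2)!)²] / [(2j+k−1)! · (2j+k−2)! · (2j+3k−1)! · (2j+3k−2)!]. -/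
noncomputable section

/-- Binomial coefficient `C(a,b)` for integers, with the convention that it vanishes
whenever `b < 0` or `b > a`. -/
def zchoose (a b : ℤ) : ℚ :=
  if 0 ≤ b ∧ b ≤ a then (Nat.choose a.toNat b.toNat : ℚ) else 0

/-- `Q_{i,j} = 2·C(i+j−2, 2j−i−2) + C(i+j−2, 2j−i−1)` for positive integers `i, j`. -/
def Qent (i j : ℕ) : ℚ :=
  2 * zchoose ((i:ℤ) + (j:ℤ) - 2) (2*(j:ℤ) - (i:ℤ) - 2)
    + zchoose ((i:ℤ) + (j:ℤ) - 2) (2*(j:ℤ) - (i:ℤ) - 1)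

open Filter Topology

/-- The Desnanot–Jacobi identity (Dodgson condensation), for an invertible interior minor. -/
theorem Matrix.det_mul_det_interior {K : Type*} [Field K] {n : ℕ}
    (M : Matrix (Fin (n + 2)) (Fin (n + 2)) K)
    (h : (M.submatrix (fun i : Fin n => i.succ.castSucc)
      fun i : Fin n => i.succ.castSucc).det ≠ 0) :
    M.det * (M.submatrix (fun i : Fin n => i.succ.castSucc) fun i : Fin n => i.succ.castSucc).det =
      (M.submatrix Fin.castSucc Fin.castSucc).det * (M.submatrix Fin.succ Fin.succ).det -
        (M.submatrix Fin.succ Fin.castSucc).det * (M.submatrix Fin.castSucc Fin.succ).det := by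
  set A := M.submatrix (fun i : Fin n => i.succ.castSucc) fun i : Fin n => i.succ.castSucc
  let _ : Invertible A := A.invertibleOfIsUnitDet h.isUnit
  let e : Fin n ⊕ Fin 2 ≃ Fin (n + 2) :=
    Equiv.ofBijective (Sum.elim (fun i : Fin n => i.succ.castSucc) ![0, Fin.last (n + 1)]) <| by
      rw [Fintype.bijective_iff_injective_and_card]
      refine ⟨?_, by simp⟩
      rintro (i | i) (j | j) hij <;> (try fin_cases i) <;> (try fin_cases j) <;>
        (simp [Fin.ext_iff] at hij ⊢; try omega)
  let f : Fin n ⊕ Fin 1 ≃ Fin (n + 1) :=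
    Equiv.ofBijective (Sum.elim Fin.succ fun _ => 0) <| by
      rw [Fintype.bijective_iff_injective_and_card]
      refine ⟨?_, by simp⟩
      rintro (i | i) (j | j) hij <;> simp [Fin.ext_iff] at hij ⊢ <;> omega
  let g : Fin n ⊕ Fin 1 ≃ Fin (n + 1) :=
    Equiv.ofBijective (Sum.elim Fin.castSucc fun _ => Fin.last n) <| by
      rw [Fintype.bijective_iff_injective_and_card]
      refine ⟨?_, by simp⟩
      rintro (i | i) (j | j) hij <;> simp [Fin.ext_iff] at hij ⊢ <;> omega
  let S : Matrix (Fin 2) (Fin 2) K := M.submatrix (e ∘ Sum.inr) (e ∘ Sum.inr) -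
    M.submatrix (e ∘ Sum.inr) (e ∘ Sum.inl) * ⅟A * M.submatrix (e ∘ Sum.inl) (e ∘ Sum.inr)
  have hM : M.det = A.det * S.det := by
    rw [← Matrix.det_submatrix_equiv_self e M, ← Matrix.det_fromBlocks₁₁]
    congr 1
    ext (i | i) (j | j) <;> rfl
  have hminor (a b : Fin 2) (X : Matrix (Fin n ⊕ Fin 1) (Fin n ⊕ Fin 1) K)
      (hX : X = M.submatrix (Sum.elim (e ∘ Sum.inl) fun _ => e (Sum.inr a))
        (Sum.elim (e ∘ Sum.inl) fun _ => e (Sum.inr b))) : X.det = A.det * S a b := by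
    have hblocks : X = Matrix.fromBlocks A (M.submatrix (e ∘ Sum.inl) fun _ => e (Sum.inr b))
        (M.submatrix (fun _ => e (Sum.inr a)) (e ∘ Sum.inl))
        (M.submatrix (fun _ => e (Sum.inr a)) fun _ => e (Sum.inr b)) := by
      rw [hX]
      ext (i | i) (j | j) <;> rfl
    rw [hblocks, Matrix.det_fromBlocks₁₁, Matrix.det_fin_one]
    rfl
  have hff (i) : (f i).castSucc = Sum.elim (e ∘ Sum.inl) (fun _ => e (Sum.inr 0)) i := by
    rcases i with i | i <;> simp [e, f]
  have hgg (i) : (g i).succ = Sum.elim (e ∘ Sum.inl) (fun _ => e (Sum.inr 1)) i := by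
    rcases i with i | i <;> simp [e, g]
  let σ : Equiv.Perm (Fin (n + 1)) := g.symm.trans f
  have hσ (i) : σ (g i) = f i := by simp [σ]
  have h00 : (M.submatrix Fin.castSucc Fin.castSucc).det = A.det * S 0 0 := by
    rw [← Matrix.det_submatrix_equiv_self f]
    exact hminor 0 0 _ (by ext i j; simp only [Matrix.submatrix_apply, hff])
  have h11 : (M.submatrix Fin.succ Fin.succ).det = A.det * S 1 1 := by
    rw [← Matrix.det_submatrix_equiv_self g]
    exact hminor 1 1 _ (by ext i j; simp only [Matrix.submatrix_apply, hgg])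
  have h10 : (Equiv.Perm.sign σ : K) * (M.submatrix Fin.succ Fin.castSucc).det =
      A.det * S 1 0 := by
    rw [← Matrix.det_permute', ← Matrix.det_submatrix_equiv_self g]
    exact hminor 1 0 _ (by ext i j; simp only [Matrix.submatrix_apply, hgg, id, hσ, hff])
  have h01 : (Equiv.Perm.sign σ : K) * (M.submatrix Fin.castSucc Fin.succ).det =
      A.det * S 0 1 := by
    rw [← Matrix.det_permute, ← Matrix.det_submatrix_equiv_self g]
    exact hminor 0 1 _ (by ext i j; simp only [Matrix.submatrix_apply, hgg, id, hσ, hff])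
  have hsign : (Equiv.Perm.sign σ : K) * (Equiv.Perm.sign σ : K) = 1 := by
    rw [← Int.cast_mul, ← Units.val_mul, Int.units_mul_self]; simp
  rw [hM, h00, h11, Matrix.det_fin_two]
  linear_combination -((M.submatrix Fin.succ Fin.castSucc).det *
    (M.submatrix Fin.castSucc Fin.succ).det) * hsign + (Equiv.Perm.sign σ : K) *
    (M.submatrix Fin.castSucc Fin.succ).det * h10 + A.det * S 1 0 * h01

theorem Real.continuous_inv_Gamma : Continuous fun x : ℝ => (Real.Gamma x)⁻¹ := by
  have h : Continuous fun x : ℝ => ((Complex.Gamma x)⁻¹).re :=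
    Complex.continuous_re.comp
      (Complex.differentiable_one_div_Gamma.continuous.comp Complex.continuous_ofReal)
  simpa only [Complex.Gamma_ofReal, ← Complex.ofReal_inv, Complex.ofReal_re] using h

theorem Real.continuousAt_Gamma_of_pos {x : ℝ} (hx : 0 < x) : ContinuousAt Real.Gamma x :=
  (Real.differentiableAt_Gamma fun m => by
    have : (0 : ℝ) ≤ m := m.cast_nonneg
    linarith).continuousAt

/-- The matrix with entries `Γ(x+y+i+j) / (Γ(x+2i-j+1) Γ(y+2j-i+1))`. -/
def gammaMatrix (n : ℕ) (x y : ℝ) : Matrix (Fin n) (Fin n) ℝ :=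
  Matrix.of fun i j => Real.Gamma (x + y + (i : ℕ) + (j : ℕ)) *
    (Real.Gamma (x + 2 * (i : ℕ) - (j : ℕ) + 1))⁻¹ * (Real.Gamma (y + 2 * (j : ℕ) - (i : ℕ) + 1))⁻¹

/-- The factors in the product evaluation of `(gammaMatrix n x y).det`. -/
def gammaFactor (i : ℕ) (x y : ℝ) : ℝ :=
  i.factorial * Real.Gamma (x + y + i) * Real.Gamma (2 * x + y + 3 * i) *
    Real.Gamma (x + 2 * y + 3 * i) * (Real.Gamma (2 * x + y + 2 * i))⁻¹ *
    (Real.Gamma (x + 2 * y + 2 * i))⁻¹ * (Real.Gamma (x + 2 * i + 1))⁻¹ *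
    (Real.Gamma (y + 2 * i + 1))⁻¹

/-- None of the linear forms occurring in `gammaFactor` takes an integer value at `(x, y)`. -/
def GammaGeneric (x y : ℝ) : Prop :=
  ∀ m : ℤ, x ≠ m ∧ y ≠ m ∧ x + y ≠ m ∧ 2 * x + y ≠ m ∧ x + 2 * y ≠ m

theorem GammaGeneric.add {x y x' y' : ℝ} (h : GammaGeneric x y) (a b : ℤ)
    (hx : x' = x + a) (hy : y' = y + b) : GammaGeneric x' y' := by
  subst hx hy
  intro m
  refine ⟨fun e => (h (m - a)).1 ?_, fun e => (h (m - b)).2.1 ?_,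
    fun e => (h (m - a - b)).2.2.1 ?_, fun e => (h (m - 2 * a - b)).2.2.2.1 ?_,
    fun e => (h (m - a - 2 * b)).2.2.2.2 ?_⟩ <;> push_cast <;> linarith

theorem Real.Gamma_add_intCast_ne_zero {x : ℝ} (h : ∀ m : ℤ, x ≠ m) (a : ℤ) :
    Real.Gamma (x + a) ≠ 0 :=
  Real.Gamma_ne_zero fun m e => h (-m - a) (by push_cast; linarith)

theorem gammaFactor_ne_zero {x y : ℝ} (h : GammaGeneric x y) (i : ℕ) : gammaFactor i x y ≠ 0 := by
  have h0 : (i.factorial : ℝ) ≠ 0 := by exact_mod_cast i.factorial_ne_zero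
  have h1 := Real.Gamma_add_intCast_ne_zero (fun m => (h m).1) (2 * i + 1)
  have h2 := Real.Gamma_add_intCast_ne_zero (fun m => (h m).2.1) (2 * i + 1)
  have h3 := Real.Gamma_add_intCast_ne_zero (fun m => (h m).2.2.1) i
  have h4 := Real.Gamma_add_intCast_ne_zero (fun m => (h m).2.2.2.1) (3 * i)
  have h5 := Real.Gamma_add_intCast_ne_zero (fun m => (h m).2.2.2.1) (2 * i)
  have h6 := Real.Gamma_add_intCast_ne_zero (fun m => (h m).2.2.2.2) (3 * i)
  have h7 := Real.Gamma_add_intCast_ne_zero (fun m => (h m).2.2.2.2) (2 * i)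
  push_cast [← add_assoc] at h1 h2 h3 h4 h5 h6 h7
  simp [gammaFactor, *]

/-- The closed form of `gammaFactor n (x+1) (y+1) - gammaFactor (n+1) x y`. -/
def gammaDefect (n : ℕ) (x y : ℝ) : ℝ :=
  x * y * (x + y) * n.factorial * Real.Gamma (x + y + n + 1) *
    Real.Gamma (2 * x + y + 3 * n + 3) * Real.Gamma (x + 2 * y + 3 * n + 3) *
    (Real.Gamma (2 * x + y + 2 * n + 3))⁻¹ * (Real.Gamma (x + 2 * y + 2 * n + 3))⁻¹ *
    (Real.Gamma (x + 2 * n + 3))⁻¹ * (Real.Gamma (y + 2 * n + 3))⁻¹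

theorem Real.inv_Gamma_eq_mul (x : ℝ) :
    (Real.Gamma x)⁻¹ = x * (Real.Gamma (x + 1))⁻¹ := by
  rcases eq_or_ne x 0 with rfl | h
  · simp
  rw [Real.Gamma_add_one h, mul_inv, mul_inv_cancel_left₀ h]

theorem gammaFactor_sub {x y : ℝ} (h : GammaGeneric x y) (n : ℕ) :
    gammaFactor n (x + 1) (y + 1) - gammaFactor (n + 1) x y = gammaDefect n x y := by
  have e1 : x + y + n + 1 ≠ 0 := fun e => (h (-n - 1)).2.2.1 (by push_cast; linarith)
  have r1 := Real.Gamma_add_one e1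
  have r2 := Real.inv_Gamma_eq_mul (x + 2 * n + 2)
  have r3 := Real.inv_Gamma_eq_mul (y + 2 * n + 2)
  have r4 := Real.inv_Gamma_eq_mul (2 * x + y + 2 * n + 2)
  have r5 := Real.inv_Gamma_eq_mul (x + 2 * y + 2 * n + 2)
  simp only [gammaFactor, gammaDefect, Nat.factorial_succ]
  push_cast
  ring_nf at r1 r2 r3 r4 r5 ⊢
  rw [r1, r2, r3, r4, r5]
  ring

theorem gammaFactor_mul_gammaDefect (n : ℕ) (x y : ℝ) :
    gammaFactor (n + 1) (x + 2) (y - 1) * gammaFactor (n + 1) (x - 1) (y + 2) *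
        gammaDefect n x y =
      gammaFactor (n + 1) x y * gammaFactor n (x + 1) (y + 1) * gammaDefect (n + 1) x y := by
  simp only [gammaFactor, gammaDefect]
  push_cast
  ring_nf

theorem gammaFactor_zero_mul {x y : ℝ} (h : GammaGeneric x y) :
    gammaFactor 0 (x + 2) (y - 1) * gammaFactor 0 (x - 1) (y + 2) =
      gammaFactor 0 x y * gammaDefect 0 x y := by
  have hs : x + y ≠ 0 := by simpa using (h 0).2.2.1
  have r1 := Real.Gamma_add_one hs
  have r2 := Real.inv_Gamma_eq_mul x
  have r3 := Real.inv_Gamma_eq_mul y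
  have n1 := Real.Gamma_add_intCast_ne_zero (fun m => (h m).2.2.2.1)
  have n2 := Real.Gamma_add_intCast_ne_zero (fun m => (h m).2.2.2.2)
  have m1 := n1 0
  have m2 := n1 3
  have m3 := n2 0
  have m4 := n2 3
  push_cast at m1 m2 m3 m4
  simp only [gammaFactor, gammaDefect]
  push_cast
  ring_nf at r1 r2 r3 m1 m2 m3 m4 ⊢
  rw [r1, r2, r3]
  field_simp
  ring

theorem prod_gammaFactor_shift {x y : ℝ} (h : GammaGeneric x y) (n : ℕ) :
    (∏ i ∈ Finset.range (n + 1), gammaFactor i (x + 2) (y - 1)) *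
        ∏ i ∈ Finset.range (n + 1), gammaFactor i (x - 1) (y + 2) =
      (∏ i ∈ Finset.range (n + 1), gammaFactor i x y) *
        (∏ i ∈ Finset.range n, gammaFactor i (x + 1) (y + 1)) * gammaDefect n x y := by
  induction n with
  | zero => simpa using gammaFactor_zero_mul h
  | succ n ih =>
    rw [Finset.prod_range_succ _ (n + 1), Finset.prod_range_succ _ (n + 1),
      Finset.prod_range_succ (fun i => gammaFactor i x y) (n + 1),
      Finset.prod_range_succ (fun i => gammaFactor i (x + 1) (y + 1)) n]
    linear_combination gammaFactor (n + 1) (x + 2) (y - 1) * gammaFactor (n + 1) (x - 1) (y + 2) *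
      ih + (∏ i ∈ Finset.range (n + 1), gammaFactor i x y) *
        (∏ i ∈ Finset.range n, gammaFactor i (x + 1) (y + 1)) * gammaFactor_mul_gammaDefect n x y

/-- Evaluation of `(gammaMatrix n x y).det` by condensation, where all factors are nonzero. -/
theorem det_gammaMatrix_of_generic (n : ℕ) {x y : ℝ} (h : GammaGeneric x y) :
    (gammaMatrix n x y).det = ∏ i ∈ Finset.range n, gammaFactor i x y := by
  induction n using Nat.twoStepInduction generalizing x y with
  | zero => simp
  | one =>
    have n1 := Real.Gamma_add_intCast_ne_zero (fun m => (h m).2.2.2.1) 0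
    have n2 := Real.Gamma_add_intCast_ne_zero (fun m => (h m).2.2.2.2) 0
    push_cast [add_zero] at n1 n2
    simp only [gammaMatrix, gammaFactor, Matrix.det_fin_one, Matrix.of_apply,
      Finset.prod_range_one, Fin.val_zero, Nat.factorial_zero, Nat.cast_zero, Nat.cast_one]
    ring_nf at n1 n2 ⊢
    field_simp
  | more n ih₀ ih₁ =>
    have hxy := h.add 1 1 (x' := x + 1) (y' := y + 1) (by simp) (by simp)
    have hx := h.add 2 (-1) (x' := x + 2) (y' := y - 1) (by simp) (by simp; ring)
    have hy := h.add (-1) 2 (x' := x - 1) (y' := y + 2) (by simp; ring) (by simp)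
    have m0 : (gammaMatrix (n + 2) x y).submatrix (fun i : Fin n => i.succ.castSucc)
        (fun i : Fin n => i.succ.castSucc) = gammaMatrix n (x + 1) (y + 1) := by
      ext i j; simp [gammaMatrix]; ring_nf
    have m1 : (gammaMatrix (n + 2) x y).submatrix Fin.castSucc Fin.castSucc =
        gammaMatrix (n + 1) x y := by
      ext i j; simp [gammaMatrix]
    have m2 : (gammaMatrix (n + 2) x y).submatrix Fin.succ Fin.succ =
        gammaMatrix (n + 1) (x + 1) (y + 1) := by
      ext i j; simp [gammaMatrix]; ring_nf
    have m3 : (gammaMatrix (n + 2) x y).submatrix Fin.succ Fin.castSucc =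
        gammaMatrix (n + 1) (x + 2) (y - 1) := by
      ext i j; simp [gammaMatrix]; ring_nf
    have m4 : (gammaMatrix (n + 2) x y).submatrix Fin.castSucc Fin.succ =
        gammaMatrix (n + 1) (x - 1) (y + 2) := by
      ext i j; simp [gammaMatrix]; ring_nf
    have hne : (∏ i ∈ Finset.range n, gammaFactor i (x + 1) (y + 1)) ≠ 0 :=
      Finset.prod_ne_zero_iff.2 fun i _ => gammaFactor_ne_zero hxy i
    have hd := Matrix.det_mul_det_interior (gammaMatrix (n + 2) x y) (by rwa [m0, ih₀ hxy])
    rw [m0, m1, m2, m3, m4, ih₀ hxy, ih₁ h, ih₁ hxy, ih₁ hx, ih₁ hy,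
      prod_gammaFactor_shift h n, ← gammaFactor_sub h n] at hd
    apply mul_right_cancel₀ hne
    rw [hd, Finset.prod_range_succ _ (n + 1),
      Finset.prod_range_succ (fun i => gammaFactor i (x + 1) (y + 1)) n]
    ring

theorem eventually_gammaGeneric (a b : ℤ) :
    ∀ᶠ t : ℝ in 𝓝[>] 0, GammaGeneric (a + t) (b + t) := by
  filter_upwards [Ioo_mem_nhdsGT (show (0 : ℝ) < 1 / 3 by norm_num)] with t ht
  have key (c : ℤ) (s : ℝ) (h0 : 0 < s) (h1 : s < 1) : (c : ℝ) + s ≠ 0 := by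
    intro e
    have l1 : (c : ℝ) < (0 : ℤ) := by push_cast; linarith
    have l2 : ((-1 : ℤ) : ℝ) < c := by push_cast; linarith
    have l1' := Int.cast_lt.1 l1
    have l2' := Int.cast_lt.1 l2
    omega
  obtain ⟨h0, h1⟩ := ht
  intro m
  refine ⟨fun e => key (a - m) t ?_ ?_ ?_, fun e => key (b - m) t ?_ ?_ ?_,
    fun e => key (a + b - m) (2 * t) ?_ ?_ ?_, fun e => key (2 * a + b - m) (3 * t) ?_ ?_ ?_,
    fun e => key (a + 2 * b - m) (3 * t) ?_ ?_ ?_⟩ <;> push_cast <;> linarith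

/-- Extension of `det_gammaMatrix_of_generic` to natural parameters by continuity. -/
theorem det_gammaMatrix_natCast {a b : ℕ} (n : ℕ) (h : 0 < a + b) :
    (gammaMatrix n a b).det = ∏ i ∈ Finset.range n, gammaFactor i a b := by
  have hab : (0 : ℝ) < a + b := by exact_mod_cast h
  have ha : (0 : ℝ) ≤ a := a.cast_nonneg
  have hb : (0 : ℝ) ≤ b := b.cast_nonneg
  have hG (u : ℝ → ℝ) (hu : ContinuousAt u 0) (hpos : 0 < u 0) :
      ContinuousAt (fun t => Real.Gamma (u t)) 0 :=
    ContinuousAt.comp (f := u) (Real.continuousAt_Gamma_of_pos hpos) hu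
  have hI (u : ℝ → ℝ) (hu : ContinuousAt u 0) :
      ContinuousAt (fun t => (Real.Gamma (u t))⁻¹) 0 :=
    ContinuousAt.comp (f := u) Real.continuous_inv_Gamma.continuousAt hu
  have hl : ContinuousAt (fun t : ℝ => (gammaMatrix n (a + t) (b + t)).det) 0 := by
    simp only [Matrix.det_apply, gammaMatrix, Matrix.of_apply]
    refine tendsto_finsetSum _ fun σ _ => Tendsto.const_smul (tendsto_finsetProd _ fun i _ => ?_) _
    refine ((hG _ (by fun_prop) ?_).mul (hI _ (by fun_prop))).mul (hI _ (by fun_prop))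
    simp only [add_zero]
    positivity
  have hr : ContinuousAt
      (fun t : ℝ => ∏ i ∈ Finset.range n, gammaFactor i (a + t) (b + t)) 0 := by
    refine tendsto_finsetProd _ fun i _ => ?_
    simp only [gammaFactor]
    refine (((((((continuousAt_const.mul (hG _ (by fun_prop) ?_)).mul (hG _ (by fun_prop) ?_)).mul
      (hG _ (by fun_prop) ?_)).mul (hI _ (by fun_prop))).mul (hI _ (by fun_prop))).mul
      (hI _ (by fun_prop))).mul (hI _ (by fun_prop))) <;>
    · simp only [add_zero]
      have : (0 : ℝ) ≤ i := i.cast_nonneg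
      linarith
  have heq := tendsto_nhds_unique_of_eventuallyEq (hl.tendsto.mono_left nhdsWithin_le_nhds)
    (hr.tendsto.mono_left nhdsWithin_le_nhds)
    ((eventually_gammaGeneric a b).mono fun t ht => det_gammaMatrix_of_generic n
      (by simpa using ht))
  simpa using heq

theorem Real.inv_Gamma_intCast_add_one_eq_zero {m : ℤ} (h : m < 0) :
    (Real.Gamma (m + 1))⁻¹ = 0 := by
  obtain ⟨l, rfl⟩ : ∃ l : ℕ, m = -l - 1 := ⟨(-m - 1).toNat, by omega⟩
  push_cast
  rw [sub_add_cancel, Real.Gamma_neg_nat_eq_zero, inv_zero]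

theorem zchoose_natCast_eq_Gamma (a : ℕ) (b : ℤ) :
    (zchoose a b : ℝ) =
      a.factorial * (Real.Gamma (b + 1))⁻¹ * (Real.Gamma ((a : ℝ) - b + 1))⁻¹ := by
  unfold zchoose
  split_ifs with h
  · obtain ⟨h0, h1⟩ := h
    lift b to ℕ using h0
    have hb : b ≤ a := by exact_mod_cast h1
    simp only [Int.toNat_natCast, Rat.cast_natCast, Int.cast_natCast]
    rw [← Nat.cast_sub hb, Real.Gamma_nat_eq_factorial, Real.Gamma_nat_eq_factorial,
      Nat.cast_choose ℝ hb]
    field_simp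
  · rcases lt_or_ge b 0 with h0 | h0
    · simp [Real.inv_Gamma_intCast_add_one_eq_zero h0]
    · have h1 : (a : ℤ) - b < 0 := by
        by_contra h2
        exact h ⟨h0, by omega⟩
      have h3 := Real.inv_Gamma_intCast_add_one_eq_zero h1
      push_cast at h3
      simp [h3]

theorem Qent_cast_eq_gammaMatrix (n k : ℕ) (i j : Fin n) :
    (Qent (i + 1 + k) (j + 1 + k) : ℝ) =
      (3 * (j : ℕ) + 3 * k + 1) * gammaMatrix n ((k + 1 : ℕ) : ℝ) k i j := by
  simp only [Qent, gammaMatrix, Matrix.of_apply]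
  obtain ⟨i, hi⟩ := i
  obtain ⟨j, hj⟩ := j
  have h0 : ((i + 1 + k : ℕ) : ℤ) + ((j + 1 + k : ℕ) : ℤ) - 2 = ((i + j + 2 * k : ℕ) : ℤ) := by
    push_cast; ring
  have r0 := Real.Gamma_nat_eq_factorial (i + j + 2 * k)
  have r1 := Real.inv_Gamma_eq_mul ((k : ℝ) + 2 * j - i)
  have r2 := Real.inv_Gamma_eq_mul ((k : ℝ) + 2 * i - j + 1)
  simp only [h0, Rat.cast_add, Rat.cast_mul, Rat.cast_ofNat, zchoose_natCast_eq_Gamma]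
  rw [← r0]
  push_cast
  ring_nf at r1 r2 ⊢
  rw [r1, r2]
  ring

theorem gammaFactor_natCast (i k : ℕ) :
    (3 * i + 3 * k + 1) * gammaFactor i ((k + 1 : ℕ) : ℝ) k =
      (i.factorial * (i + 2 * k).factorial * ((3 * i + 3 * k + 1).factorial : ℝ) ^ 2) /
        ((2 * i + k + 1).factorial * (2 * i + k).factorial * (2 * i + 3 * k + 1).factorial *
          (2 * i + 3 * k).factorial) := by
  have r1 := Real.Gamma_nat_eq_factorial (i + 2 * k)
  have r2 := Real.Gamma_nat_eq_factorial (3 * i + 3 * k + 1)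
  have r3 := Real.Gamma_nat_eq_factorial (3 * i + 3 * k)
  have r4 := Real.Gamma_nat_eq_factorial (2 * i + k + 1)
  have r5 := Real.Gamma_nat_eq_factorial (2 * i + k)
  have r6 := Real.Gamma_nat_eq_factorial (2 * i + 3 * k + 1)
  have r7 := Real.Gamma_nat_eq_factorial (2 * i + 3 * k)
  have r8 : ((3 * i + 3 * k + 1).factorial : ℝ) =
      (3 * i + 3 * k + 1) * (3 * i + 3 * k).factorial := by
    rw [Nat.factorial_succ]; push_cast; ring
  simp only [gammaFactor]
  push_cast at r1 r2 r3 r4 r5 r6 r7 ⊢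
  ring_nf at r1 r2 r3 r4 r5 r6 r7 r8 ⊢
  simp only [r1, r2, r3, r4, r5, r6, r7, r8]
  ring

theorem det_Q_eq (n k : ℕ) (hk : k ≤ n) :
    Matrix.det (Matrix.of fun i j : Fin (n-k) => Qent ((i:ℕ)+1+k) ((j:ℕ)+1+k)) =
      ∏ j ∈ Finset.Icc 1 (n - k),
        (((j-1).factorial : ℚ) * ((j+2*k-1).factorial : ℚ) * ((3*j+3*k-2).factorial : ℚ)^2) /
          (((2*j+k-1).factorial : ℚ) * ((2*j+k-2).factorial : ℚ) * ((2*j+3*k-1).factorial : ℚ) *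
            ((2*j+3*k-2).factorial : ℚ)) := by
  apply Rat.cast_injective (α := ℝ)
  have hmat : (Matrix.of fun i j : Fin (n - k) => Qent (i + 1 + k) (j + 1 + k)).map
      (Rat.castHom ℝ) = Matrix.of fun i j : Fin (n - k) =>
        (3 * ((j : ℕ) : ℝ) + 3 * k + 1) * gammaMatrix (n - k) ((k + 1 : ℕ) : ℝ) k i j := by
    ext i j
    exact Qent_cast_eq_gammaMatrix _ k i j
  rw [← Rat.coe_castHom, RingHom.map_det, RingHom.mapMatrix_apply, hmat,
    Matrix.det_mul_row (fun j : Fin (n - k) => 3 * ((j : ℕ) : ℝ) + 3 * k + 1),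
    det_gammaMatrix_natCast _ (by omega),
    Fin.prod_univ_eq_prod_range (fun j : ℕ => 3 * (j : ℝ) + 3 * k + 1), ← Finset.prod_mul_distrib,
    map_prod, ← Finset.Ico_add_one_right_eq_Icc, Finset.prod_Ico_eq_prod_range,
    Nat.add_sub_cancel]
  refine Finset.prod_congr rfl fun i _ => ?_
  have s1 : 1 + i - 1 = i := by omega
  have s2 : 1 + i + 2 * k - 1 = i + 2 * k := by omega
  have s3 : 3 * (1 + i) + 3 * k - 2 = 3 * i + 3 * k + 1 := by omega
  have s4 : 2 * (1 + i) + k - 1 = 2 * i + k + 1 := by omega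
  have s5 : 2 * (1 + i) + k - 2 = 2 * i + k := by omega
  have s6 : 2 * (1 + i) + 3 * k - 1 = 2 * i + 3 * k + 1 := by omega
  have s7 : 2 * (1 + i) + 3 * k - 2 = 2 * i + 3 * k := by omega
  rw [gammaFactor_natCast, s1, s2, s3, s4, s5, s6, s7]
  simp
end
end

section
/- Let n ≥ 1 and 1 ≤ k ≤ n be integers, and define CSSCPP(2n,k) = Π_{j=1}^{n−k} [(j−1)! · (j+2k−1)! · ((3j+3k−2)!)²] / [(2j+k−1)! · (2j+k−2)! · (2j+3k−1)! · (2j+3k−2)!] (an empty product equals 1). Then CSSCPP(2n,k−1) / CSSCPP(2n,k) = [(2k−2)! · (2k−1)! · (2n+k−1)! · (n−k)!] / [(k−1)! · (3k−3)! · (3k−1) · (2n−k)! · (n+k−1)!]. -/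
noncomputable section

/-- `CSSCPP (n, k)` : the number of `k`-Punctured Cyclically Symmetric Self-Complementary
Plane Partitions of size `2n`, given by the product formula. -/
def CSSCPP (n k : ℕ) : ℚ :=
  ∏ j ∈ Finset.Icc 1 (n - k),
    (((j-1).factorial : ℚ) * ((j+2*k-1).factorial : ℚ) * ((3*j+3*k-2).factorial : ℚ)^2) /
      (((2*j+k-1).factorial : ℚ) * ((2*j+k-2).factorial : ℚ) * ((2*j+3*k-1).factorial : ℚ) *
        ((2*j+3*k-2).factorial : ℚ))

/-- The `j`-th factor of the product formula, with `j` shifted to start from `0`. -/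
def CSSCPPFactor (k j : ℕ) : ℚ :=
  ((j.factorial : ℚ) * ((j+2*k).factorial : ℚ) * ((3*j+3*k+1).factorial : ℚ)^2) /
    (((2*j+k+1).factorial : ℚ) * ((2*j+k).factorial : ℚ) * ((2*j+3*k+1).factorial : ℚ) *
      ((2*j+3*k).factorial : ℚ))

theorem CSSCPPFactor_ne_zero (k j : ℕ) : CSSCPPFactor k j ≠ 0 := by
  unfold CSSCPPFactor
  positivity

theorem CSSCPP_add_eq_prod_range (m k : ℕ) :
    CSSCPP (k + m) k = ∏ j ∈ Finset.range m, CSSCPPFactor k j := by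
  unfold CSSCPP CSSCPPFactor
  rw [Nat.add_sub_cancel_left]
  induction m with
  | zero => simp
  | succ m ih =>
    rw [Finset.prod_Icc_succ_top (by omega), Finset.prod_range_succ, ih,
      show m+1-1 = m by omega, show m+1+2*k-1 = m+2*k by omega,
      show 3*(m+1)+3*k-2 = 3*m+3*k+1 by omega, show 2*(m+1)+k-1 = 2*m+k+1 by omega,
      show 2*(m+1)+k-2 = 2*m+k by omega, show 2*(m+1)+3*k-1 = 2*m+3*k+1 by omega,
      show 2*(m+1)+3*k-2 = 2*m+3*k by omega]

theorem CSSCPPFactor_zero (q : ℕ) :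
    CSSCPPFactor q 0 =
      (((2*q).factorial : ℚ) * ((2*q+1).factorial : ℚ) * ((3*q+2).factorial : ℚ)) /
      ((q.factorial : ℚ) * ((3*q).factorial : ℚ) * (3*q+2) *
        ((q+1).factorial : ℚ) * ((2*q+1).factorial : ℚ)) := by
  have h : (3*q+2 : ℚ) ≠ 0 := by positivity
  simp only [CSSCPPFactor, mul_zero, zero_add, Nat.factorial_zero,
    Nat.factorial_succ (3*q+1)]
  push_cast
  field_simp
  ring

theorem CSSCPPFactor_succ (q m : ℕ) :
    CSSCPPFactor q (m+1) =
      CSSCPPFactor (q+1) m * (((m+1) * (2*m+3*q+4) * (2*m+3*q+3)) /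
        ((m+2*q+2) * (2*m+q+3) * (2*m+q+2))) := by
  unfold CSSCPPFactor
  rw [show m+1+2*q = m+2*q+1 by ring, show m+2*(q+1) = m+2*q+1+1 by ring,
    show 3*(m+1)+3*q+1 = 3*m+3*q+4 by ring, show 3*m+3*(q+1)+1 = 3*m+3*q+4 by ring,
    show 2*(m+1)+q+1 = 2*m+q+1+1+1 by ring, show 2*(m+1)+q = 2*m+q+1+1 by ring,
    show 2*m+(q+1)+1 = 2*m+q+1+1 by ring, show 2*m+(q+1) = 2*m+q+1 by ring,
    show 2*(m+1)+3*q+1 = 2*m+3*q+2+1 by ring, show 2*(m+1)+3*q = 2*m+3*q+2 by ring,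
    show 2*m+3*(q+1)+1 = 2*m+3*q+2+1+1 by ring, show 2*m+3*(q+1) = 2*m+3*q+2+1 by ring]
  simp only [Nat.factorial_succ m, Nat.factorial_succ (m+2*q+1), Nat.factorial_succ (2*m+q+1+1),
    Nat.factorial_succ (2*m+q+1), Nat.factorial_succ (2*m+3*q+2+1),
    Nat.factorial_succ (2*m+3*q+2)]
  push_cast
  field_simp
  ring

theorem prod_CSSCPPFactor_ratio (q m : ℕ) :
    (∏ j ∈ Finset.range (m+1), CSSCPPFactor q j) / ∏ j ∈ Finset.range m, CSSCPPFactor (q+1) j =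
      (((2*q).factorial : ℚ) * ((2*q+1).factorial : ℚ) * ((2*m+3*q+2).factorial : ℚ) *
        (m.factorial : ℚ)) /
      ((q.factorial : ℚ) * ((3*q).factorial : ℚ) * (3*q+2) *
        ((2*m+q+1).factorial : ℚ) * ((m+2*q+1).factorial : ℚ)) := by
  induction m with
  | zero => simpa using CSSCPPFactor_zero q
  | succ m ih =>
    rw [Finset.prod_range_succ _ (m+1), Finset.prod_range_succ (CSSCPPFactor (q+1)) m,
      mul_div_mul_comm (∏ j ∈ Finset.range (m+1), CSSCPPFactor q j), ih,
      CSSCPPFactor_succ, mul_div_cancel_left₀ _ (CSSCPPFactor_ne_zero _ _),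
      show 2*(m+1)+3*q+2 = 2*m+3*q+2+1+1 by ring, show 2*(m+1)+q+1 = 2*m+q+1+1+1 by ring,
      show m+1+2*q+1 = m+2*q+1+1 by ring]
    simp only [Nat.factorial_succ m, Nat.factorial_succ (m+2*q+1),
      Nat.factorial_succ (2*m+q+1+1), Nat.factorial_succ (2*m+q+1),
      Nat.factorial_succ (2*m+3*q+2+1), Nat.factorial_succ (2*m+3*q+2)]
    push_cast
    field_simp
    ring

theorem CSSCPP_ratio (n k : ℕ) (hn : 1 ≤ n) (hk : 1 ≤ k) (hkn : k ≤ n) :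
    CSSCPP n (k-1) / CSSCPP n k =
      (((2*k-2).factorial : ℚ) * ((2*k-1).factorial : ℚ) * ((2*n+k-1).factorial : ℚ) *
        ((n-k).factorial : ℚ)) /
      (((k-1).factorial : ℚ) * ((3*k-3).factorial : ℚ) * ((3*k-1 : ℕ) : ℚ) *
        ((2*n-k).factorial : ℚ) * ((n+k-1).factorial : ℚ)) := by
  obtain ⟨q, rfl⟩ : ∃ q, k = q + 1 := ⟨k - 1, by omega⟩
  obtain ⟨m, rfl⟩ : ∃ m, n = q + 1 + m := ⟨n - (q + 1), by omega⟩
  rw [CSSCPP_add_eq_prod_range, show q+1-1 = q by omega, show q+1+m = q+(m+1) by ring,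
    CSSCPP_add_eq_prod_range, prod_CSSCPPFactor_ratio,
    show 2*(q+1)-2 = 2*q by omega, show 2*(q+1)-1 = 2*q+1 by omega,
    show 2*(q+(m+1))+(q+1)-1 = 2*m+3*q+2 by omega, show q+(m+1)-(q+1) = m by omega,
    show 3*(q+1)-3 = 3*q by omega, show 3*(q+1)-1 = 3*q+2 by omega,
    show 2*(q+(m+1))-(q+1) = 2*m+q+1 by omega, show q+(m+1)+(q+1)-1 = m+2*q+1 by omega]
  push_cast
  rfl
end
end

section
/- Let q, z₁, z₂ ∈ ℂ with q ≠ 0, qz₂ − q^{−1}z₁ ≠ 0 and qz₁ − q^{−1}z₂ ≠ 0. Then the 4×4 matrix identity Ř(z₁/z₂) · diag(z₁z₂, z₁, z₂, 1) = diag(z₁z₂, z₂, z₁, 1) · Ř*(z₂/z₁) holds, where Ř*(z) denotes Ř(z) with q replaced by q^{−1}. -/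
noncomputable section

/-- Spin configurations; `true` = spin up `↑`. -/
abbrev Cfg (N : ℕ) := Fin N → Bool

/-- `Ř(z₁/z₂)` written homogeneously: in the ordered basis `(↑↑, ↑↓, ↓↑, ↓↓)` of
`ℂ²⊗ℂ²` (`true = ↑`), `Rcheck q z₁ z₂` is the matrix `Ř(z) = P·R(z)` with
`z = z₁/z₂`, all entries written with the common denominator `q z₂ − q⁻¹ z₁`
(numerator and denominator of each entry of `Ř(z₁/z₂)` multiplied by `z₂`). -/
def Rcheck (q z1 z2 : ℂ) : Matrix (Bool × Bool) (Bool × Bool) ℂ :=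
  Matrix.of fun p c =>
    match p, c with
    | (true, true), (true, true) => (q * z1 - q⁻¹ * z2) / (q * z2 - q⁻¹ * z1)
    | (false, false), (false, false) => (q * z1 - q⁻¹ * z2) / (q * z2 - q⁻¹ * z1)
    | (true, false), (true, false) => (q - q⁻¹) * z2 / (q * z2 - q⁻¹ * z1)
    | (true, false), (false, true) => (z1 - z2) / (q * z2 - q⁻¹ * z1)
    | (false, true), (true, false) => (z1 - z2) / (q * z2 - q⁻¹ * z1)
    | (false, true), (false, true) => (q - q⁻¹) * z1 / (q * z2 - q⁻¹ * z1)
    | _, _ => 0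

theorem Rcheck_diag_identity (q z1 z2 : ℂ) (hq : q ≠ 0)
    (h1 : q * z2 - q⁻¹ * z1 ≠ 0) (h2 : q * z1 - q⁻¹ * z2 ≠ 0) :
    Rcheck q z1 z2 *
        Matrix.diagonal (fun p : Bool × Bool =>
          (if p.1 then z1 else 1) * (if p.2 then z2 else 1)) =
      Matrix.diagonal (fun p : Bool × Bool =>
          (if p.1 then z2 else 1) * (if p.2 then z1 else 1)) *
        Rcheck q⁻¹ z2 z1 := by
  have hneg : q⁻¹ * z1 - q * z2 = -(q * z2 - q⁻¹ * z1) := by ring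
  ext ⟨a, b⟩ ⟨c, d⟩
  rw [Matrix.mul_diagonal, Matrix.diagonal_mul]
  cases a <;> cases b <;> cases c <;> cases d <;>
    simp only [Rcheck, Matrix.of_apply, inv_inv, hneg, if_true, Bool.false_eq_true, if_false,
      div_neg] <;>
    ring
end
end

section
/- Let r, s ≥ 0 be integers and let ρ̃₁ < ρ̃₂ < … < ρ̃_{r+s} and σ̃₁ < σ̃₂ < … < σ̃_{r+s} be strictly increasing sequences of nonnegative integers. Let M be the (2r+2s)×(2r+2s) matrix over the polynomial ring ℂ[z₁,…,z_r, y₁,…,y_{2s}] whose rows are: for 1 ≤ i ≤ r, the row (z_i^{ρ̃₁},…,z_i^{ρ̃_{r+s}}, 0,…,0); for 1 ≤ i ≤ r, the row (0,…,0, z_i^{σ̃₁},…,z_i^{σ̃_{r+s}}); and for 1 ≤ α ≤ 2s, the row (y_α^{ρ̃₁},…,y_α^{ρ̃_{r+s}}, y_α^{σ̃₁},…,y_α^{σ̃_{r+s}}). Then det M is divisible in ℂ[z₁,…,z_r, y₁,…,y_{2s}] by Π_{1≤i<j≤r}(z_i−z_j)² · Π_{1≤i<j≤2s}(y_i−y_j)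 · Π_{1≤i≤r, 1≤j≤2s}(z_i−y_j). -/
noncomputable section

open MvPolynomial

/-- The `(2r+2s)×(2r+2s)` matrix `M` over `ℂ[z₁,…,z_r,y₁,…,y_{2s}]`
(the variable `z_i` is `X (Sum.inl i)`, the variable `y_α` is `X (Sum.inr α)`):
rows `1..r` are `(z_i^{ρ̃₁},…,z_i^{ρ̃_{r+s}},0,…,0)`, rows `r+1..2r` are
`(0,…,0,z_i^{σ̃₁},…,z_i^{σ̃_{r+s}})`, and the last `2s` rows are
`(y_α^{ρ̃₁},…,y_α^{ρ̃_{r+s}},y_α^{σ̃₁},…,y_α^{σ̃_{r+s}})`. -/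
def Mrs (r s : ℕ) (ρ σ : ℕ → ℕ) :
    Matrix (Fin (2*(r+s))) (Fin (2*(r+s))) (MvPolynomial (Fin r ⊕ Fin (2*s)) ℂ) :=
  Matrix.of fun a b =>
    if (a.val < r ∧ r + s ≤ b.val) ∨ (r ≤ a.val ∧ a.val < 2*r ∧ b.val < r + s) then 0
    else
      (if h1 : a.val < r then X (Sum.inl ⟨a.val, h1⟩)
        else if h2 : a.val < 2*r then X (Sum.inl ⟨a.val - r, by omega⟩)
        else X (Sum.inr ⟨a.val - 2*r, by have := a.isLt; omega⟩))
      ^ (if b.val < r + s then ρ b.val else σ (b.val - (r + s)))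

namespace Matrix

variable {n R : Type*} [Fintype n] [DecidableEq n] [CommRing R]

theorem det_updateRow_sub_self (A : Matrix n n R) {i j : n} (hij : i ≠ j) :
    (A.updateRow i (A i - A j)).det = A.det := by
  simpa [sub_eq_add_neg] using det_updateRow_add_smul_self A hij (-1)

/-- If two rows of `A` agree modulo `p`, then `p` can be factored out of one of them. -/
theorem exists_det_eq_mul_det_updateRow (A : Matrix n n R) {i j : n} (hij : i ≠ j) {p : R}
    (h : ∀ k, p ∣ A i k - A j k) : ∃ v : n → R, A.det = p * (A.updateRow i v).det := by
  choose v hv using h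
  refine ⟨v, ?_⟩
  rw [← det_updateRow_sub_self A hij, ← det_updateRow_smul]
  congr 2
  ext k
  simp [hv k]

theorem dvd_det_of_dvd_row_sub (A : Matrix n n R) {i j : n} (hij : i ≠ j) {p : R}
    (h : ∀ k, p ∣ A i k - A j k) : p ∣ A.det :=
  let ⟨_, hv⟩ := exists_det_eq_mul_det_updateRow A hij h
  ⟨_, hv⟩

theorem mul_dvd_det_of_dvd_row_sub (A : Matrix n n R) {i j i' j' : n} (hij : i ≠ j)
    (hij' : i' ≠ j') (hii' : i' ≠ i) (hji' : j' ≠ i) {p q : R}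
    (h : ∀ k, p ∣ A i k - A j k) (h' : ∀ k, q ∣ A i' k - A j' k) : p * q ∣ A.det := by
  obtain ⟨v, hv⟩ := exists_det_eq_mul_det_updateRow A hij h
  rw [hv]
  refine mul_dvd_mul_left p (dvd_det_of_dvd_row_sub _ hij' fun k => ?_)
  rw [updateRow_ne hii', updateRow_ne hji']
  exact h' k

theorem dvd_det_of_dvd_row_sub_sub (A : Matrix n n R) {i j j' : n} (hij : i ≠ j)
    (hij' : i ≠ j') {p : R} (h : ∀ k, p ∣ A i k - A j k - A j' k) : p ∣ A.det := by
  rw [← det_updateRow_sub_self A hij]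
  refine dvd_det_of_dvd_row_sub _ hij' fun k => ?_
  rw [updateRow_self, updateRow_ne hij'.symm]
  exact h k

end Matrix

namespace MvPolynomial

variable {τ R : Type*} [CommRing R] [IsDomain R]

theorem irreducible_X_sub_X {a b : τ} (hab : a ≠ b) :
    Irreducible (X a - X b : MvPolynomial τ R) := by
  have h := irreducible_mul_X_add (1 : MvPolynomial τ R) (-X b) a one_ne_zero
    (by simp) (by simpa [vars_neg] using hab) isRelPrime_one_left
  simpa [sub_eq_add_neg] using h

theorem isRelPrime_X_sub_X {a b c d : τ} (hab : a ≠ b) (hcd : c ≠ d)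
    (h : ¬(a = c ∧ b = d)) (h' : ¬(a = d ∧ b = c)) :
    IsRelPrime (X a - X b : MvPolynomial τ R) (X c - X d) := by
  classical
  rw [(irreducible_X_sub_X hab).isRelPrime_iff_not_dvd]
  intro hdvd
  have h0 := map_dvd (rename (Function.update id b a) : MvPolynomial τ R →ₐ[R] _) hdvd
  simp only [map_sub, rename_X, Function.update_of_ne hab, Function.update_self, id_eq, sub_self,
    zero_dvd_iff, sub_eq_zero] at h0
  have h1 := X_injective h0
  simp only [Function.update_apply, id_eq] at h1
  grind

end MvPolynomial

section Rows

variable (r s : ℕ) (ρ σ : ℕ → ℕ)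

theorem Mrs_z_rho (i : Fin r) (k : Fin (2*(r+s))) :
    Mrs r s ρ σ ⟨i, by omega⟩ k = if k.val < r + s then X (Sum.inl i) ^ ρ k else 0 := by
  have := i.isLt
  simp only [Mrs, Matrix.of_apply]
  split_ifs <;> first | rfl | omega

theorem Mrs_z_sigma (i : Fin r) (k : Fin (2*(r+s))) :
    Mrs r s ρ σ ⟨r + i, by omega⟩ k =
      if k.val < r + s then 0 else X (Sum.inl i) ^ σ (k - (r + s)) := by
  have := i.isLt
  simp only [Mrs, Matrix.of_apply, Nat.add_sub_cancel_left]
  split_ifs <;> first | rfl | omega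

theorem Mrs_y (α : Fin (2*s)) (k : Fin (2*(r+s))) :
    Mrs r s ρ σ ⟨2*r + α, by omega⟩ k =
      if k.val < r + s then X (Sum.inr α) ^ ρ k else X (Sum.inr α) ^ σ (k - (r + s)) := by
  have := α.isLt
  simp only [Mrs, Matrix.of_apply, Nat.add_sub_cancel_left]
  split_ifs <;> first | rfl | omega

theorem z_sub_z_sq_dvd_det_Mrs {i j : Fin r} (hij : i ≠ j) :
    (X (Sum.inl i) - X (Sum.inl j)) ^ 2 ∣ (Mrs r s ρ σ).det := by
  have hne : (i : ℕ) ≠ j := Fin.val_ne_of_ne hij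
  rw [sq]
  refine Matrix.mul_dvd_det_of_dvd_row_sub _
    (i := ⟨i, by omega⟩) (j := ⟨j, by omega⟩) (i' := ⟨r + i, by omega⟩) (j' := ⟨r + j, by omega⟩)
    ?_ ?_ ?_ ?_ (fun k => ?_) (fun k => ?_)
  any_goals (simp only [ne_eq, Fin.mk.injEq]; omega)
  · rw [Mrs_z_rho, Mrs_z_rho]
    split_ifs
    · exact sub_dvd_pow_sub_pow _ _ _
    · simp
  · rw [Mrs_z_sigma, Mrs_z_sigma]
    split_ifs
    · simp
    · exact sub_dvd_pow_sub_pow _ _ _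

theorem y_sub_y_dvd_det_Mrs {i j : Fin (2*s)} (hij : i ≠ j) :
    (X (Sum.inr i) - X (Sum.inr j)) ∣ (Mrs r s ρ σ).det := by
  have hne : (i : ℕ) ≠ j := Fin.val_ne_of_ne hij
  refine Matrix.dvd_det_of_dvd_row_sub _
    (i := ⟨2*r + i, by omega⟩) (j := ⟨2*r + j, by omega⟩) ?_ (fun k => ?_)
  · simp only [ne_eq, Fin.mk.injEq]; omega
  · rw [Mrs_y, Mrs_y]
    split_ifs <;> exact sub_dvd_pow_sub_pow _ _ _

theorem z_sub_y_dvd_det_Mrs (i : Fin r) (j : Fin (2*s)) :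
    (X (Sum.inl i) - X (Sum.inr j)) ∣ (Mrs r s ρ σ).det := by
  rw [← neg_dvd, neg_sub]
  refine Matrix.dvd_det_of_dvd_row_sub_sub _
    (i := ⟨2*r + j, by omega⟩) (j := ⟨i, by omega⟩) (j' := ⟨r + i, by omega⟩)
    ?_ ?_ (fun k => ?_)
  any_goals (simp only [ne_eq, Fin.mk.injEq]; omega)
  rw [Mrs_y, Mrs_z_rho, Mrs_z_sigma]
  split_ifs <;> simp only [sub_zero] <;> exact sub_dvd_pow_sub_pow _ _ _

end Rows

theorem det_M_divisible (r s : ℕ) (ρ σ : ℕ → ℕ)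
    (hρ : ∀ a b : ℕ, a < b → b < r + s → ρ a < ρ b)
    (hσ : ∀ a b : ℕ, a < b → b < r + s → σ a < σ b) :
    (∏ i : Fin r, ∏ j : Fin r,
        if (i:ℕ) < (j:ℕ) then
          ((X (Sum.inl i) - X (Sum.inl j) : MvPolynomial (Fin r ⊕ Fin (2*s)) ℂ))^2 else 1) *
      (∏ i : Fin (2*s), ∏ j : Fin (2*s),
        if (i:ℕ) < (j:ℕ) then (X (Sum.inr i) - X (Sum.inr j)) else 1) *
      (∏ i : Fin r, ∏ j : Fin (2*s), (X (Sum.inl i) - X (Sum.inr j)))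
      ∣ (Mrs r s ρ σ).det := by
  simp only [← Fintype.prod_prod_type']
  refine IsRelPrime.mul_dvd (IsRelPrime.mul_left ?_ ?_) (IsRelPrime.mul_dvd ?_ ?_ ?_) ?_
  · refine IsRelPrime.prod_left fun p _ => IsRelPrime.prod_right fun q _ => ?_
    split_ifs with hp
    · exact (isRelPrime_X_sub_X (by simp; omega) (by simp) (by simp) (by simp)).pow_left
    · exact isRelPrime_one_left
  · refine IsRelPrime.prod_left fun p _ => IsRelPrime.prod_right fun q _ => ?_
    split_ifs with hp
    · exact isRelPrime_X_sub_X (by simp; omega) (by simp) (by simp) (by simp)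
    · exact isRelPrime_one_left
  · refine IsRelPrime.prod_left fun p _ => IsRelPrime.prod_right fun q _ => ?_
    split_ifs with hp hq
    · exact (isRelPrime_X_sub_X (by simp; omega) (by simp; omega) (by simp) (by simp)).pow_left
    · exact isRelPrime_one_right
    all_goals exact isRelPrime_one_left
  · refine Fintype.prod_dvd_of_isRelPrime (fun p q hpq => ?_) fun p => ?_
    · rw [ne_eq, Prod.ext_iff] at hpq
      simp only [Function.onFun]
      split_ifs with hp hq
      · exact (isRelPrime_X_sub_X (by simp; omega) (by simp; omega) (by simpa using hpq)
          (by simp; omega)).pow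
      · exact isRelPrime_one_right
      all_goals exact isRelPrime_one_left
    · split_ifs with hp
      · exact z_sub_z_sq_dvd_det_Mrs r s ρ σ (Fin.ne_of_lt hp)
      · exact one_dvd _
  · refine Fintype.prod_dvd_of_isRelPrime (fun p q hpq => ?_) fun p => ?_
    · rw [ne_eq, Prod.ext_iff] at hpq
      simp only [Function.onFun]
      split_ifs with hp hq
      · exact isRelPrime_X_sub_X (by simp; omega) (by simp; omega) (by simpa using hpq)
          (by simp; omega)
      · exact isRelPrime_one_right
      all_goals exact isRelPrime_one_left
    · split_ifs with hp
      · exact y_sub_y_dvd_det_Mrs r s ρ σ (Fin.ne_of_lt hp)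
      · exact one_dvd _
  · refine Fintype.prod_dvd_of_isRelPrime (fun p q hpq => ?_)
      fun p => z_sub_y_dvd_det_Mrs r s ρ σ p.1 p.2
    rw [ne_eq, Prod.ext_iff] at hpq
    exact isRelPrime_X_sub_X (by simp) (by simp) (by simpa using hpq) (by simp)
end
end
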